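/- The two-qutrit channel Φ(ρ) = (1/9)·Σ_{i,j=0}^{2} (X^{2i}Z^i ⊗ X^j Z^j) ρ (X^{2i}Z^i ⊗ X^j Z^j)† has pairwise commuting Kraus operators, and it privatizes the subalgebra generated by X²⊗X and XZ²⊗Z: for every element b of that subalgebra, Φ(b) = (tr(b)/9)·I₉. -/

import Mathlib

open Matrix Complex Kronecker

noncomputable def TX : Matrix (Fin 3) (Fin 3) ℂ := !![0, 1, 0; 0, 0, 1; 1, 0, 0]

noncomputable def TZ : Matrix (Fin 3) (Fin 3) ℂ :=
  !![1, 0, 0; 0, Complex.exp (2 * Real.pi * I / 3), 0;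
     0, 0, (Complex.exp (2 * Real.pi * I / 3)) ^ 2]

/-- The Kraus operators `X^{2i}Z^i ⊗ X^j Z^j` of the two-qutrit channel. -/
noncomputable def qutritKraus (i j : Fin 3) :
    Matrix (Fin 3 × Fin 3) (Fin 3 × Fin 3) ℂ :=
  (TX ^ (2 * (i : ℕ)) * TZ ^ (i : ℕ)) ⊗ₖ (TX ^ (j : ℕ) * TZ ^ (j : ℕ))

/-- The two-qutrit channel `Φ(ρ) = (1/9)·Σ_{i,j} K_{ij} ρ K_{ij}†`. -/
noncomputable def qutritChannel (ρ : Matrix (Fin 3 × Fin 3) (Fin 3 × Fin 3) ℂ) :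
    Matrix (Fin 3 × Fin 3) (Fin 3 × Fin 3) ℂ :=
  (1 / 9 : ℂ) • ∑ i : Fin 3, ∑ j : Fin 3, qutritKraus i j * ρ * (qutritKraus i j)ᴴ

section Weyl

local notation "ω₃" => Complex.exp (2 * Real.pi * I / 3)

theorem isPrimitiveRoot_cubeRoot : IsPrimitiveRoot ω₃ 3 := by
  simpa using Complex.isPrimitiveRoot_exp 3 (by norm_num)

theorem cubeRoot_pow_three_mul (k : ℕ) : ω₃ ^ (3 * k) = 1 := by
  rw [pow_mul, isPrimitiveRoot_cubeRoot.pow_eq_one, one_pow]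

theorem star_cubeRoot : star ω₃ = ω₃ ^ 2 := by
  have h3 : ω₃ ^ 3 = 1 := isPrimitiveRoot_cubeRoot.pow_eq_one
  have hn : ‖ω₃‖ = 1 := isPrimitiveRoot_cubeRoot.norm'_eq_one (by norm_num)
  have h1 : ω₃ * star ω₃ = 1 := by
    have h := Complex.mul_conj ω₃
    rw [Complex.normSq_eq_norm_sq, hn] at h
    simpa using h
  calc star ω₃ = ω₃ ^ 3 * star ω₃ := by rw [h3, one_mul]
    _ = ω₃ ^ 2 * (ω₃ * star ω₃) := by ring
    _ = ω₃ ^ 2 := by rw [h1, mul_one]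

theorem sum_cubeRoot_pow_mul {t : ℕ} (ht : ¬ 3 ∣ t) :
    ∑ i : Fin 3, ω₃ ^ ((i : ℕ) * t) = 0 := by
  have h1 : ω₃ ^ t ≠ 1 := fun h => ht ((isPrimitiveRoot_cubeRoot.pow_eq_one_iff_dvd t).1 h)
  have h3 : (ω₃ ^ t) ^ 3 = 1 := by
    rw [pow_right_comm, isPrimitiveRoot_cubeRoot.pow_eq_one, one_pow]
  have h : (ω₃ ^ t - 1) * (1 + ω₃ ^ t + (ω₃ ^ t) ^ 2) = 0 := by linear_combination h3
  have h' := (mul_eq_zero.1 h).resolve_left (sub_ne_zero.2 h1)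
  simp only [Fin.sum_univ_three, mul_comm _ t, pow_mul]
  simpa using h'

theorem TX_pow_three : TX ^ 3 = 1 := by
  ext i j
  fin_cases i <;> fin_cases j <;> simp [TX, pow_succ, Matrix.mul_apply, Fin.sum_univ_three]

theorem TZ_eq_diagonal : TZ = diagonal fun i : Fin 3 => ω₃ ^ (i : ℕ) := by
  ext i j
  fin_cases i <;> fin_cases j <;> simp [TZ]

theorem TZ_pow_three : TZ ^ 3 = 1 := by
  rw [TZ_eq_diagonal, diagonal_pow, ← diagonal_one]
  congr 1
  ext i
  simp only [Pi.pow_apply]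
  rw [pow_right_comm, isPrimitiveRoot_cubeRoot.pow_eq_one, one_pow]

theorem TX_conjTranspose : TXᴴ = TX ^ 2 := by
  ext i j
  fin_cases i <;> fin_cases j <;>
    simp [TX, pow_succ, Matrix.mul_apply, Fin.sum_univ_three, conjTranspose_apply]

theorem TZ_conjTranspose : TZᴴ = TZ ^ 2 := by
  rw [TZ_eq_diagonal, diagonal_conjTranspose, diagonal_pow]
  congr 1
  ext i
  simp only [Pi.star_apply, Pi.pow_apply, star_pow, star_cubeRoot]
  ring

theorem TZ_mul_TX : TZ * TX = ω₃ ^ 2 • (TX * TZ) := by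
  have h : ω₃ ^ 3 = 1 := isPrimitiveRoot_cubeRoot.pow_eq_one
  have h4 : ω₃ ^ 2 * ω₃ = 1 := by rw [← h]; ring
  have h5 : ω₃ ^ 2 * ω₃ ^ 2 = ω₃ := by linear_combination ω₃ * h
  rw [TZ_eq_diagonal]
  ext i j
  rw [Matrix.smul_apply, diagonal_mul, mul_diagonal]
  fin_cases i <;> fin_cases j <;> simp [TX, h4, h5]

theorem TZ_mul_TX_pow (p : ℕ) : TZ * TX ^ p = ω₃ ^ (2 * p) • (TX ^ p * TZ) := by
  induction p with
  | zero => simp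
  | succ p ih =>
    rw [pow_succ, ← mul_assoc, ih, smul_mul_assoc, mul_assoc (TX ^ p), TZ_mul_TX, mul_smul_comm,
      smul_smul, ← pow_add, mul_assoc (TX ^ p), mul_add_one]

theorem TZ_pow_mul_TX_pow (n p : ℕ) :
    TZ ^ n * TX ^ p = ω₃ ^ (2 * n * p) • (TX ^ p * TZ ^ n) := by
  induction n with
  | zero => simp
  | succ n ih =>
    rw [pow_succ, mul_assoc, TZ_mul_TX_pow, mul_smul_comm, ← mul_assoc, ih, smul_mul_assoc,
      smul_smul, ← pow_add, mul_assoc (TX ^ p)]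
    congr 2
    ring

/-- The one-qutrit Weyl operator `X^m Z^n`. -/
noncomputable def weyl (m n : ℕ) : Matrix (Fin 3) (Fin 3) ℂ := TX ^ m * TZ ^ n

theorem weyl_mul (m n p q : ℕ) :
    weyl m n * weyl p q = ω₃ ^ (2 * n * p) • weyl (m + p) (n + q) := by
  unfold weyl
  rw [mul_assoc, ← mul_assoc (TZ ^ n), TZ_pow_mul_TX_pow, smul_mul_assoc, mul_smul_comm,
    pow_add, pow_add]
  simp only [mul_assoc]

theorem weyl_commute (m n p q : ℕ) :
    weyl m n * weyl p q = ω₃ ^ (2 * n * p + q * m) • (weyl p q * weyl m n) := by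
  rw [weyl_mul, weyl_mul, smul_smul, ← pow_add, add_comm p, add_comm q,
    show 2 * n * p + q * m + 2 * q * m = 2 * n * p + 3 * (q * m) by ring, pow_add,
    cubeRoot_pow_three_mul, mul_one]

theorem weyl_conjTranspose (m n : ℕ) :
    (weyl m n)ᴴ = ω₃ ^ (8 * n * m) • weyl (2 * m) (2 * n) := by
  unfold weyl
  rw [conjTranspose_mul, conjTranspose_pow, conjTranspose_pow, TX_conjTranspose,
    TZ_conjTranspose, ← pow_mul, ← pow_mul, TZ_pow_mul_TX_pow]
  congr 2
  ring

theorem weyl_three_mul (m n : ℕ) : weyl (3 * m) (3 * n) = 1 := by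
  rw [weyl, pow_mul, pow_mul, TX_pow_three, TZ_pow_three, one_pow, one_pow, one_mul]

theorem weyl_mul_conjTranspose (m n : ℕ) : weyl m n * (weyl m n)ᴴ = 1 := by
  rw [weyl_conjTranspose, mul_smul_comm, weyl_mul, smul_smul, ← pow_add,
    show 8 * n * m + 2 * n * (2 * m) = 3 * (4 * n * m) by ring, cubeRoot_pow_three_mul, one_smul,
    show m + 2 * m = 3 * m by ring, show n + 2 * n = 3 * n by ring, weyl_three_mul]

theorem qutritKraus_eq (i j : Fin 3) :
    qutritKraus i j = weyl (2 * (i : ℕ)) i ⊗ₖ weyl j j := rfl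

theorem qutritKraus_mul_conjTranspose (i j : Fin 3) :
    qutritKraus i j * (qutritKraus i j)ᴴ = 1 := by
  rw [qutritKraus_eq, conjTranspose_kronecker, ← mul_kronecker_mul, weyl_mul_conjTranspose,
    weyl_mul_conjTranspose, one_kronecker_one]

theorem qutritKraus_commute (i j i' j' : Fin 3) :
    qutritKraus i j * qutritKraus i' j' = qutritKraus i' j' * qutritKraus i j := by
  rw [qutritKraus_eq, qutritKraus_eq, ← mul_kronecker_mul, ← mul_kronecker_mul,
    weyl_commute (2 * (i : ℕ)), weyl_commute (j : ℕ),
    show 2 * (i : ℕ) * (2 * (i' : ℕ)) + i' * (2 * (i : ℕ)) = 3 * (2 * (i * i')) by ring,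
    show 2 * (j : ℕ) * (j' : ℕ) + j' * (j : ℕ) = 3 * (j * j') by ring,
    cubeRoot_pow_three_mul, cubeRoot_pow_three_mul, one_smul, one_smul]

/-- Up to a phase, the product `(X² ⊗ X)^a (XZ² ⊗ Z)^b`. -/
noncomputable def privateWeyl (a b : ℕ) : Matrix (Fin 3 × Fin 3) (Fin 3 × Fin 3) ℂ :=
  weyl (2 * a + b) (2 * b) ⊗ₖ weyl a b

theorem privateWeyl_mul (a b c d : ℕ) : ∃ k : ℕ,
    privateWeyl a b * privateWeyl c d = ω₃ ^ k • privateWeyl (a + c) (b + d) := by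
  refine ⟨2 * b * c + 2 * (2 * b) * (2 * c + d), ?_⟩
  unfold privateWeyl
  rw [← mul_kronecker_mul, weyl_mul, weyl_mul, smul_kronecker, kronecker_smul, smul_smul,
    ← pow_add, show 2 * a + b + (2 * c + d) = 2 * (a + c) + (b + d) by ring, ← mul_add,
    add_comm (2 * b * c)]

theorem privateWeyl_conjTranspose (a b : ℕ) : ∃ k : ℕ,
    (privateWeyl a b)ᴴ = ω₃ ^ k • privateWeyl (2 * a) (2 * b) := by
  refine ⟨8 * (2 * b) * (2 * a + b) + 8 * b * a, ?_⟩
  unfold privateWeyl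
  rw [conjTranspose_kronecker, weyl_conjTranspose, weyl_conjTranspose, smul_kronecker,
    kronecker_smul, smul_smul, ← pow_add, mul_add 2 (2 * a)]

theorem privateWeyl_three_mul (a b : ℕ) : privateWeyl (3 * a) (3 * b) = 1 := by
  rw [privateWeyl, weyl_three_mul, show 2 * (3 * a) + 3 * b = 3 * (2 * a + b) by ring,
    show 2 * (3 * b) = 3 * (2 * b) by ring, weyl_three_mul, one_kronecker_one]

theorem qutritKraus_conj_privateWeyl (i j : Fin 3) (a b : ℕ) :
    qutritKraus i j * privateWeyl a b * (qutritKraus i j)ᴴ =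
      (ω₃ ^ ((i : ℕ) * a) * ω₃ ^ ((j : ℕ) * (2 * a + b))) • privateWeyl a b := by
  have h : qutritKraus i j * privateWeyl a b =
      (ω₃ ^ ((i : ℕ) * a) * ω₃ ^ ((j : ℕ) * (2 * a + b))) •
        (privateWeyl a b * qutritKraus i j) := by
    rw [qutritKraus_eq, privateWeyl, ← mul_kronecker_mul, ← mul_kronecker_mul,
      weyl_commute (2 * (i : ℕ)), weyl_commute (j : ℕ), smul_kronecker, kronecker_smul, smul_smul,
      show 2 * (i : ℕ) * (2 * a + b) + 2 * b * (2 * (i : ℕ)) = i * a + 3 * (i * a + 2 * i * b) by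
        ring,
      show 2 * (j : ℕ) * a + b * j = j * (2 * a + b) by ring,
      pow_add, cubeRoot_pow_three_mul, mul_one]
  rw [h, smul_mul_assoc, mul_assoc (privateWeyl a b), qutritKraus_mul_conjTranspose, mul_one]

theorem qutritChannel_privateWeyl_eq_smul (a b : ℕ) :
    qutritChannel (privateWeyl a b) =
      ((1 / 9 : ℂ) * ((∑ i : Fin 3, ω₃ ^ ((i : ℕ) * a)) *
        ∑ j : Fin 3, ω₃ ^ ((j : ℕ) * (2 * a + b)))) • privateWeyl a b := by
  simp only [qutritChannel, qutritKraus_conj_privateWeyl]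
  rw [mul_smul, Finset.sum_mul_sum]
  simp only [Finset.sum_smul]

theorem conjTranspose_mul_qutritKraus (i j : Fin 3) :
    (qutritKraus i j)ᴴ * qutritKraus i j = 1 :=
  mul_eq_one_comm.1 (qutritKraus_mul_conjTranspose i j)

theorem trace_qutritChannel (ρ : Matrix (Fin 3 × Fin 3) (Fin 3 × Fin 3) ℂ) :
    (qutritChannel ρ).trace = ρ.trace := by
  simp only [qutritChannel, trace_smul, trace_sum, trace_mul_cycle _ ρ,
    conjTranspose_mul_qutritKraus, one_mul]
  simp
  ring

theorem qutritChannel_one : qutritChannel 1 = 1 := by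
  simp only [qutritChannel, mul_one, qutritKraus_mul_conjTranspose]
  simp only [Finset.sum_const, Finset.card_univ, Fintype.card_fin, ← Nat.cast_smul_eq_nsmul ℂ,
    smul_smul]
  norm_num

theorem qutritChannel_privateWeyl (a b : ℕ) :
    qutritChannel (privateWeyl a b) = ((privateWeyl a b).trace / 9) • 1 := by
  by_cases h : 3 ∣ a ∧ 3 ∣ b
  · obtain ⟨⟨a, rfl⟩, ⟨b, rfl⟩⟩ := h
    rw [privateWeyl_three_mul, qutritChannel_one, trace_one]
    norm_num
  · have h0 : qutritChannel (privateWeyl a b) = 0 := by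
      rw [qutritChannel_privateWeyl_eq_smul]
      by_cases ha : 3 ∣ a
      · have hb : ¬ 3 ∣ 2 * a + b := by omega
        rw [sum_cubeRoot_pow_mul hb, mul_zero, mul_zero, zero_smul]
      · rw [sum_cubeRoot_pow_mul ha, zero_mul, mul_zero, zero_smul]
    rw [← trace_qutritChannel, h0, trace_zero, zero_div, zero_smul]

theorem qutritChannel_add (ρ σ : Matrix (Fin 3 × Fin 3) (Fin 3 × Fin 3) ℂ) :
    qutritChannel (ρ + σ) = qutritChannel ρ + qutritChannel σ := by
  simp only [qutritChannel, mul_add, add_mul, Finset.sum_add_distrib, smul_add]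

theorem qutritChannel_smul (c : ℂ) (ρ : Matrix (Fin 3 × Fin 3) (Fin 3 × Fin 3) ℂ) :
    qutritChannel (c • ρ) = c • qutritChannel ρ := by
  simp only [qutritChannel, mul_smul_comm, smul_mul_assoc, ← Finset.smul_sum, smul_comm c]

theorem exists_eq_smul_privateWeyl {x : Matrix (Fin 3 × Fin 3) (Fin 3 × Fin 3) ℂ}
    (hx : x ∈ Submonoid.closure (({(TX ^ 2) ⊗ₖ TX, (TX * TZ ^ 2) ⊗ₖ TZ} :
        Set (Matrix (Fin 3 × Fin 3) (Fin 3 × Fin 3) ℂ)) ∪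
      star {(TX ^ 2) ⊗ₖ TX, (TX * TZ ^ 2) ⊗ₖ TZ})) :
    ∃ k a b : ℕ, x = ω₃ ^ k • privateWeyl a b := by
  have hA : (TX ^ 2) ⊗ₖ TX = privateWeyl 1 0 := by simp [privateWeyl, weyl]
  have hB : (TX * TZ ^ 2) ⊗ₖ TZ = privateWeyl 0 1 := by simp [privateWeyl, weyl]
  rw [hA, hB] at hx
  induction hx using Submonoid.closure_induction with
  | mem x hx =>
    have of_star : ∀ a b, star x = privateWeyl a b → ∃ k a b : ℕ, x = ω₃ ^ k • privateWeyl a b := by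
      intro a b h
      obtain ⟨k, hk⟩ := privateWeyl_conjTranspose a b
      exact ⟨k, 2 * a, 2 * b, by rw [← hk, ← h, star_eq_conjTranspose, conjTranspose_conjTranspose]⟩
    rcases hx with (rfl | rfl) | (h | h)
    · exact ⟨0, 1, 0, by simp⟩
    · exact ⟨0, 0, 1, by simp⟩
    · exact of_star _ _ h
    · exact of_star _ _ h
  | one => exact ⟨0, 0, 0, by simpa using (privateWeyl_three_mul 0 0).symm⟩
  | mul x y _ _ hx hy =>
    obtain ⟨k, a, b, rfl⟩ := hx
    obtain ⟨l, c, d, rfl⟩ := hy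
    obtain ⟨m, hm⟩ := privateWeyl_mul a b c d
    refine ⟨l + k + m, a + c, b + d, ?_⟩
    rw [smul_mul_assoc, mul_smul_comm, hm, smul_smul, smul_smul, pow_add, pow_add]
    congr 1
    ring

end Weyl

/-- The two-qutrit channel has pairwise commuting Kraus operators, yet privatizes the
*-subalgebra generated by `X²⊗X` and `XZ²⊗Z`. -/
theorem stmt17 :
    (∀ i j i' j' : Fin 3, qutritKraus i j * qutritKraus i' j' =
      qutritKraus i' j' * qutritKraus i j) ∧
    (∀ b ∈ (StarAlgebra.adjoin ℂ
        {(TX ^ 2) ⊗ₖ TX, (TX * TZ ^ 2) ⊗ₖ TZ} :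
        StarSubalgebra ℂ (Matrix (Fin 3 × Fin 3) (Fin 3 × Fin 3) ℂ)),
      qutritChannel b = (Matrix.trace b / 9) • (1 : Matrix (Fin 3 × Fin 3) (Fin 3 × Fin 3) ℂ)) := by
  refine ⟨qutritKraus_commute, fun b hb => ?_⟩
  rw [← StarSubalgebra.mem_toSubalgebra, StarAlgebra.adjoin_toSubalgebra,
    ← Subalgebra.mem_toSubmodule, Algebra.adjoin_eq_span] at hb
  induction hb using Submodule.span_induction with
  | mem x hx =>
    obtain ⟨k, a, c, rfl⟩ := exists_eq_smul_privateWeyl hx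
    rw [qutritChannel_smul, qutritChannel_privateWeyl, trace_smul, smul_smul, smul_eq_mul,
      mul_div_assoc (_ ^ k)]
  | zero => simp [qutritChannel]
  | add x y _ _ hx hy => rw [qutritChannel_add, hx, hy, trace_add, add_div, add_smul]
  | smul c x _ hx =>
    rw [qutritChannel_smul, hx, trace_smul, smul_smul, smul_eq_mul, mul_div_assoc]
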